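/- Let D ⊂ ℂⁿ be a bounded domain carrying a Kähler metric g whose holomorphic sectional curvature is bounded above by a negative constant −C₁ < 0. Then √(g(v,v)) ≤ C₁' · K_D(p, v) for all p ∈ D, v ∈ ℂⁿ, where K_D is the Kobayashi infinitesimal metric and C₁' depends only on C₁. -/

import Mathlib

open Set Metric

/-- Wirtinger derivative `∂f/∂z_k` of `f : ℂⁿ → ℂ` at `z`. -/
noncomputable def wDeriv {n : ℕ} (f : (Fin n → ℂ) → ℂ) (z : Fin n → ℂ) (k : Fin n) : ℂ :=
  (1 / 2) * (fderiv ℝ f z (Pi.single k 1) - Complex.I * fderiv ℝ f z (Pi.single k Complex.I))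

/-- Conjugate Wirtinger derivative `∂f/∂z̄_k` of `f : ℂⁿ → ℂ` at `z`. -/
noncomputable def wbDeriv {n : ℕ} (f : (Fin n → ℂ) → ℂ) (z : Fin n → ℂ) (k : Fin n) : ℂ :=
  (1 / 2) * (fderiv ℝ f z (Pi.single k 1) + Complex.I * fderiv ℝ f z (Pi.single k Complex.I))

/-- The Hermitian form `Σ g_{i j̄} v_i \bar{w}_j` of a Hermitian metric tensor `g`. -/
noncomputable def hermForm {n : ℕ} (g : (Fin n → ℂ) → Matrix (Fin n) (Fin n) ℂ)
    (z v w : Fin n → ℂ) : ℂ :=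
  ∑ i, ∑ j, g z i j * v i * (starRingEnd ℂ) (w j)

/-- `g` is a smooth Hermitian metric on the open set `Ω ⊆ ℂⁿ`. -/
structure IsHermitianMetricOn {n : ℕ} (Ω : Set (Fin n → ℂ))
    (g : (Fin n → ℂ) → Matrix (Fin n) (Fin n) ℂ) : Prop where
  smooth : ∀ i j, ContDiffOn ℝ (⊤ : ℕ∞) (fun z => g z i j) Ω
  hermitian : ∀ z ∈ Ω, (g z).IsHermitian
  posdef : ∀ z ∈ Ω, ∀ v : Fin n → ℂ, v ≠ 0 → 0 < (hermForm g z v v).re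

/-- `g` is a Kähler metric on `Ω`: a Hermitian metric whose coefficients satisfy the Kähler
symmetry `∂_k g_{i j̄} = ∂_i g_{k j̄}`. -/
structure IsKahlerMetricOn {n : ℕ} (Ω : Set (Fin n → ℂ))
    (g : (Fin n → ℂ) → Matrix (Fin n) (Fin n) ℂ) extends IsHermitianMetricOn Ω g : Prop where
  kahler : ∀ z ∈ Ω, ∀ i j k, wDeriv (fun w => g w i j) z k = wDeriv (fun w => g w k j) z i

/-- The curvature tensor `R_{i j̄ k l̄}` of a Hermitian metric `g`:
`R_{i j̄ k l̄} = -∂_k ∂_{l̄} g_{i j̄} + Σ_{p,q} g^{q̄ p} (∂_k g_{i q̄})(∂_{l̄} g_{p j̄})`. -/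
noncomputable def curvTensor {n : ℕ} (g : (Fin n → ℂ) → Matrix (Fin n) (Fin n) ℂ)
    (z : Fin n → ℂ) (i j k l : Fin n) : ℂ :=
  - wDeriv (fun w => wbDeriv (fun u => g u i j) w l) z k
    + ∑ p, ∑ q, (g z)⁻¹ q p * wDeriv (fun w => g w i q) z k * wbDeriv (fun w => g w p j) z l

/-- The holomorphic sectional curvature of `g` at `z` in the direction `v`:
`H(v) = R(v, v̄, v, v̄) / g(v,v)²`. -/
noncomputable def holSecCurv {n : ℕ} (g : (Fin n → ℂ) → Matrix (Fin n) (Fin n) ℂ)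
    (z v : Fin n → ℂ) : ℝ :=
  (∑ i, ∑ j, ∑ k, ∑ l, curvTensor g z i j k l * v i * (starRingEnd ℂ) (v j) * v k *
    (starRingEnd ℂ) (v l)).re / ((hermForm g z v v).re) ^ 2

/-- The Ricci curvature of a Kähler metric: `Ric_{i j̄} = -∂_i ∂_{j̄} log det g`. -/
noncomputable def ricci {n : ℕ} (g : (Fin n → ℂ) → Matrix (Fin n) (Fin n) ℂ)
    (z : Fin n → ℂ) (i j : Fin n) : ℂ :=
  - wDeriv (fun w => wbDeriv (fun u => Complex.log ((g u).det)) w j) z i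

/-- The Riemannian distance on `(Ω, g)`: infimum of `g`-lengths of `C¹` paths in `Ω`. -/
noncomputable def riemDistK {n : ℕ} (Ω : Set (Fin n → ℂ))
    (g : (Fin n → ℂ) → Matrix (Fin n) (Fin n) ℂ) (p q : Fin n → ℂ) : ℝ :=
  sInf {L : ℝ | ∃ γ : ℝ → (Fin n → ℂ), ContDiffOn ℝ 1 γ (Icc 0 1) ∧
    MapsTo γ (Icc 0 1) Ω ∧ γ 0 = p ∧ γ 1 = q ∧
    L = ∫ t in (0:ℝ)..1, Real.sqrt ((hermForm g (γ t) (derivWithin γ (Icc 0 1) t)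
      (derivWithin γ (Icc 0 1) t)).re)}

/-- `(Ω, g)` is complete: every `riemDistK`-Cauchy sequence converges in `Ω`. -/
def IsCompleteMetricOn {n : ℕ} (Ω : Set (Fin n → ℂ))
    (g : (Fin n → ℂ) → Matrix (Fin n) (Fin n) ℂ) : Prop :=
  ∀ x : ℕ → (Fin n → ℂ), (∀ k, x k ∈ Ω) →
    (∀ ε > (0:ℝ), ∃ N : ℕ, ∀ k ≥ N, ∀ m ≥ N, riemDistK Ω g (x k) (x m) < ε) →
    ∃ y ∈ Ω, Filter.Tendsto (fun k => riemDistK Ω g (x k) y) Filter.atTop (nhds 0)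

/-- The Kobayashi infinitesimal pseudometric of a domain `D`. -/
noncomputable def kobMetric {E : Type*} [NormedAddCommGroup E] [NormedSpace ℂ E]
    (D : Set E) (p v : E) : ℝ :=
  sInf {α : ℝ | 0 < α ∧ ∃ f : ℂ → E, DifferentiableOn ℂ f (ball (0:ℂ) 1) ∧
    MapsTo f (ball (0:ℂ) 1) D ∧ f 0 = p ∧ fderiv ℂ f 0 1 = α⁻¹ • v}

section helpers

open ComplexConjugate Filter Topology

/-- `F` is real differentiable at `z` with `∂F = a`, `∂̄F = b`. -/
def HasW (F : ℂ → ℂ) (a b z : ℂ) : Prop :=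
  ∃ L : ℂ →L[ℝ] ℂ, HasFDerivAt F L z ∧ ∀ h, L h = a * h + b * conj h

lemma HasW.mul {F G : ℂ → ℂ} {a b a' b' z : ℂ} (h1 : HasW F a b z) (h2 : HasW G a' b' z) :
    HasW (fun x => F x * G x) (a * G z + F z * a') (b * G z + F z * b') z := by
  obtain ⟨L, hL, e⟩ := h1
  obtain ⟨M, hM, e'⟩ := h2
  refine ⟨_, hL.mul hM, fun h => ?_⟩
  simp [e, e']
  ring

lemma HasW.add {F G : ℂ → ℂ} {a b a' b' z : ℂ} (h1 : HasW F a b z) (h2 : HasW G a' b' z) :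
    HasW (fun x => F x + G x) (a + a') (b + b') z := by
  obtain ⟨L, hL, e⟩ := h1
  obtain ⟨M, hM, e'⟩ := h2
  refine ⟨_, hL.add hM, fun h => ?_⟩
  simp [e, e']
  ring

lemma HasW.sum {ι : Type*} {s : Finset ι} {F : ι → ℂ → ℂ} {a b : ι → ℂ} {z : ℂ}
    (h : ∀ i ∈ s, HasW (F i) (a i) (b i) z) :
    HasW (fun x => ∑ i ∈ s, F i x) (∑ i ∈ s, a i) (∑ i ∈ s, b i) z := by
  classical
  induction s using Finset.induction_on with
  | empty =>
    refine ⟨0, ?_, by simp⟩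
    simpa using hasFDerivAt_const (0:ℂ) z
  | insert i s hi ih =>
    simp only [Finset.sum_insert hi]
    exact (h i (by simp)).add (ih fun j hj => h j (by simp [hj]))

lemma HasW.sum_ex {ι : Type*} {s : Finset ι} {F : ι → ℂ → ℂ} {a : ι → ℂ} {z : ℂ}
    (h : ∀ i, ∃ b, HasW (F i) (a i) b z) :
    ∃ b, HasW (fun x => ∑ i ∈ s, F i x) (∑ i ∈ s, a i) b z := by
  choose b hb using h
  exact ⟨_, HasW.sum fun i _ => hb i⟩

lemma HasW.cast_left {F : ℂ → ℂ} {a a' b z : ℂ} (h : HasW F a b z) (e : a' = a) :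
    HasW F a' b z := e ▸ h

lemma HasW.conj {F : ℂ → ℂ} {a b z : ℂ} (h1 : HasW F a b z) :
    HasW (fun x => conj (F x)) (conj b) (conj a) z := by
  obtain ⟨L, hL, e⟩ := h1
  refine ⟨_, (Complex.conjCLE.toContinuousLinearMap.hasFDerivAt (x := F z)).comp z hL, fun h => ?_⟩
  simp [e]
  ring

lemma HasW.const (c z : ℂ) : HasW (fun _ => c) 0 0 z :=
  ⟨0, hasFDerivAt_const c z, by simp⟩

lemma HasW.of_hasDerivAt {F : ℂ → ℂ} {a z : ℂ} (h : HasDerivAt F a z) : HasW F a 0 z := by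
  refine ⟨_, h.hasFDerivAt.restrictScalars ℝ, fun h => ?_⟩
  simp [mul_comm]

lemma HasW.congr {F G : ℂ → ℂ} {a b z : ℂ} (h : HasW F a b z) (e : G =ᶠ[𝓝 z] F) :
    HasW G a b z := by
  obtain ⟨L, hL, e'⟩ := h
  exact ⟨L, hL.congr_of_eventuallyEq e, e'⟩

lemma HasW.continuousAt {F : ℂ → ℂ} {a b z : ℂ} (h : HasW F a b z) : ContinuousAt F z := by
  obtain ⟨L, hL, e'⟩ := h
  exact hL.continuousAt

lemma HasW.unique {F : ℂ → ℂ} {a b a' b' z : ℂ} (h : HasW F a b z) (h' : HasW F a' b' z) :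
    a = a' ∧ b = b' := by
  obtain ⟨L, hL, e⟩ := h
  obtain ⟨M, hM, e'⟩ := h'
  have := hL.unique hM
  subst this
  have h1 := (e 1).symm.trans (e' 1)
  have h2 := (e Complex.I).symm.trans (e' Complex.I)
  simp at h1 h2
  have h3 : a - b = a' - b' := by
    apply mul_right_cancel₀ Complex.I_ne_zero
    linear_combination h2
  constructor
  · linear_combination (h1 + h3) / 2
  · linear_combination (h1 - h3) / 2

/-- directional derivative of the real part -/
lemma HasW.line {F : ℂ → ℂ} {a b z e : ℂ} {t : ℝ} (h : HasW F a b (z + t * e)) :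
    HasDerivAt (fun s : ℝ => F (z + s * e)) (a * e + b * conj e) t := by
  obtain ⟨L, hL, e'⟩ := h
  have h1 : HasDerivAt (fun s : ℝ => z + (s:ℂ) * e) e t := by
    have := ((Complex.ofRealCLM.hasDerivAt (x := t)).mul_const e).const_add z
    simpa using this
  have := hL.comp_hasDerivAt t h1
  rw [e'] at this
  exact this

lemma second_deriv_nonpos {f f' : ℝ → ℝ} {c : ℝ} (hm : IsLocalMax f 0)
    (h1 : ∀ᶠ t in 𝓝 0, HasDerivAt f (f' t) t) (h2 : HasDerivAt f' c 0) : c ≤ 0 := by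
  by_contra! hc
  have hd : deriv f =ᶠ[𝓝 0] f' := h1.mono fun t ht => ht.deriv
  have hdd : deriv (deriv f) 0 = c := by rw [hd.deriv_eq, h2.deriv]
  have hmin : IsLocalMin f 0 := isLocalMin_of_deriv_deriv_pos (by rw [hdd]; exact hc)
    hm.deriv_eq_zero h1.self_of_nhds.continuousAt
  have hconst : f =ᶠ[𝓝 0] fun _ => f 0 := by
    filter_upwards [hm, hmin] with t a b using le_antisymm a b
  have := hconst.deriv.deriv_eq
  rw [hdd] at this
  simp at this
  linarith

lemma HasW.max_test {φ P Q : ℂ → ℂ} {a b z : ℂ} (hm : IsLocalMax (fun x => (φ x).re) z)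
    (h1 : ∀ᶠ x in 𝓝 z, HasW φ (P x) (Q x) x) (hPQ : ∀ᶠ x in 𝓝 z, P x = conj (Q x))
    (h2 : HasW Q a b z) : Q z = 0 ∧ a.re ≤ 0 := by
  have key : ∀ e : ℂ, (Q z * conj e).re = 0 ∧ (a * e * conj e + b * conj e * conj e).re ≤ 0 := by
    intro e
    have hcont : Tendsto (fun s : ℝ => z + (s:ℂ) * e) (𝓝 0) (𝓝 z) := by
      have : ContinuousAt (fun s : ℝ => z + (s:ℂ) * e) 0 := by fun_prop
      simpa [ContinuousAt] using this
    have hm' : IsLocalMax (fun s : ℝ => (φ (z + s * e)).re) 0 := by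
      have := hcont.eventually hm
      simpa [IsLocalMax, IsMaxFilter] using this
    have hd : ∀ᶠ t : ℝ in 𝓝 0, HasDerivAt (fun s : ℝ => (φ (z + s * e)).re)
        (2 * (Q (z + t * e) * conj e).re) t := by
      filter_upwards [hcont.eventually h1, hcont.eventually hPQ] with t ht hp
      have h3 := Complex.reCLM.hasFDerivAt.comp_hasDerivAt t ht.line
      have : 2 * (Q (z + t * e) * conj e).re =
          Complex.reCLM (P (z + t * e) * e + Q (z + t * e) * conj e) := by
        rw [hp]; simp; ring
      rw [this]
      exact h3
    have h0 := hm'.hasDerivAt_eq_zero hd.self_of_nhds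
    have h2' : HasW Q a b (z + ((0:ℝ):ℂ) * e) := by simpa using h2
    have h4 : HasDerivAt (fun t : ℝ => 2 * (Q (z + t * e) * conj e).re)
        (2 * ((a * e + b * conj e) * conj e).re) 0 :=
      (Complex.reCLM.hasFDerivAt.comp_hasDerivAt 0 (h2'.line.mul_const (conj e))).const_mul 2
    have h5 := second_deriv_nonpos hm' hd h4
    constructor
    · simpa using h0
    · rw [← add_mul]; linarith
  have k1 := key 1
  have k2 := key Complex.I
  simp at k1 k2
  exact ⟨Complex.ext k1.1 k2.1, by linarith [k1.2, k2.2]⟩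

lemma ahlfors {u P Q T : ℂ → ℂ} {C : ℝ} (hC : 0 < C)
    (h1 : ∀ z ∈ ball (0:ℂ) 1, HasW u (P z) (Q z) z)
    (hPQ : ∀ z ∈ ball (0:ℂ) 1, P z = conj (Q z))
    (hr : ∀ z ∈ ball (0:ℂ) 1, (u z).im = 0)
    (h2 : ∀ z ∈ ball (0:ℂ) 1, ∃ b, HasW Q (T z) b z)
    (hT : ∀ z ∈ ball (0:ℂ) 1, 0 < (u z).re →
      C * (u z).re ^ 3 + Complex.normSq (P z) ≤ (u z).re * (T z).re) :
    (u 0).re ≤ 8 / C := by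
  by_cases hu0 : (u 0).re ≤ 0
  · exact hu0.trans (by positivity)
  push Not at hu0
  let w : ℂ → ℂ := fun z => 1 / 4 + (-1) * (z * conj z)
  have hw : ∀ z, HasW w (-conj z) (-z) z := by
    intro z
    have hid : HasW (fun z => z) 1 0 z := HasW.of_hasDerivAt (hasDerivAt_id z)
    have := (HasW.const (1/4) z).add ((HasW.const (-1) z).mul (hid.mul hid.conj))
    simpa [w] using this
  have hwr : ∀ z, w z = ((1 / 4 - Complex.normSq z : ℝ) : ℂ) := by
    intro z; simp [w, Complex.mul_conj]; ring
  let φ : ℂ → ℂ := fun z => u z * (w z * w z)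
  have hφr : ∀ z, (φ z).re = (u z).re * (1 / 4 - Complex.normSq z) ^ 2 := by
    intro z
    simp only [φ, hwr, ← Complex.ofReal_mul, Complex.re_mul_ofReal]
    ring
  have hsub : closedBall (0:ℂ) (1/2) ⊆ ball 0 1 := closedBall_subset_ball (by norm_num)
  have hcont : ContinuousOn (fun z => (φ z).re) (closedBall 0 (1/2)) := by
    intro z hz
    have := ((h1 z (hsub hz)).mul ((hw z).mul (hw z))).continuousAt
    exact (Complex.continuous_re.continuousAt.comp this).continuousWithinAt
  obtain ⟨z, hz, hmax⟩ := (isCompact_closedBall (0:ℂ) (1/2)).exists_isMaxOn ⟨0, by simp⟩ hcont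
  have hge : (u 0).re * (1/4)^2 ≤ (φ z).re := by
    have := hmax (show (0:ℂ) ∈ closedBall 0 (1/2) by simp)
    simp only [mem_ofPred_eq] at this
    rw [hφr 0] at this
    simpa using this
  have hpos : 0 < (φ z).re := lt_of_lt_of_le (by positivity) hge
  have hzle : Complex.normSq z ≤ 1/4 := by
    rw [Complex.normSq_eq_norm_sq]
    have : ‖z‖ ≤ 1/2 := by simpa using hz
    nlinarith [norm_nonneg z]
  have hzlt : Complex.normSq z < 1/4 := by
    refine lt_of_le_of_ne hzle fun h => ?_
    rw [hφr, h] at hpos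
    simp at hpos
  have hzb : z ∈ ball (0:ℂ) (1/2) := by
    rw [Complex.normSq_eq_norm_sq] at hzlt
    have : ‖z‖ < 1/2 := by nlinarith [norm_nonneg z]
    simpa using this
  have hz1 := hsub hz
  have hupos : 0 < (u z).re := by
    rw [hφr] at hpos
    exact pos_of_mul_pos_left hpos (sq_nonneg _)
  have hloc : IsLocalMax (fun x => (φ x).re) z :=
    hmax.isLocalMax (mem_of_superset (isOpen_ball.mem_nhds hzb) ball_subset_closedBall)
  have hev : ∀ᶠ x in 𝓝 z, x ∈ ball (0:ℂ) 1 := isOpen_ball.mem_nhds hz1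
  obtain ⟨b, hb⟩ := h2 z hz1
  have hQφ := (hb.mul ((hw z).mul (hw z))).add
    ((h1 z hz1).mul (((HasW.of_hasDerivAt (hasDerivAt_id z)).mul (hw z)).mul (HasW.const (-2) z)))
  simp only [id] at hQφ
  obtain ⟨hq, ha⟩ := HasW.max_test (P := fun x => P x * (w x * w x) +
      u x * (conj x * w x * (-2)))
    (Q := fun x => Q x * (w x * w x) + u x * (x * w x * (-2))) hloc
    (by
      filter_upwards [hev] with x hx
      have := (h1 x hx).mul ((hw x).mul (hw x))
      convert this using 1 <;> ring)
    (by
      filter_upwards [hev] with x hx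
      have hu : conj (u x) = u x := Complex.conj_eq_iff_im.2 (hr x hx)
      have hww : conj (w x) = w x := by rw [hwr]; exact Complex.conj_ofReal _
      simp [hPQ x hx, hu, hww, map_ofNat])
    hQφ
  -- final algebra
  have hT' := hT z hz1 hupos
  set s := Complex.normSq z with hs
  set U := (u z).re with hU
  have huz : u z = (U : ℂ) := Complex.ext rfl (by simp [hr z hz1])
  set ω : ℝ := 1/4 - s with hω
  have hωpos : 0 < ω := by linarith
  have hwz : w z = (ω : ℂ) := hwr z
  have hωne : (ω : ℂ) ≠ 0 := by exact_mod_cast hωpos.ne'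
  have hQ : Q z * ω = 2 * U * z := by
    rw [hwz, huz] at hq
    apply mul_right_cancel₀ hωne
    linear_combination hq
  have hP : P z * ω = 2 * U * conj z := by
    have := congrArg conj hQ
    simpa [hPQ z hz1, map_ofNat] using this
  have hzz : z * conj z = (s:ℂ) := Complex.mul_conj z
  have hn : Complex.normSq (P z) * ω ^ 2 = 4 * U ^ 2 * s := by
    have := congrArg Complex.normSq hP
    simp [Complex.normSq_mul] at this
    rw [← hs] at this
    linarith
  have ha2 : (T z).re * ω ^ 2 - 6 * U * s - 2 * U * ω ≤ 0 := by
    have e : T z * ((ω ^ 2 : ℝ) : ℂ) - ((6 * U * s + 2 * U * ω : ℝ) : ℂ) =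
      T z * (w z * w z) + Q z * (-(starRingEnd ℂ) z * w z + w z * -(starRingEnd ℂ) z) +
      (P z * (z * w z * -2) + u z * ((1 * w z + z * -(starRingEnd ℂ) z) * -2 + z * w z * 0)) := by
      rw [hwz, huz]
      push_cast
      linear_combination 2 * conj z * hQ + 2 * z * hP - (-6 * U) * hzz
    rw [← e, Complex.sub_re, Complex.re_mul_ofReal, Complex.ofReal_re] at ha
    linarith
  have hfin : C * (U * ω ^ 2) ≤ 1 / 2 := by
    have h6 : U * (C * U ^ 2 * ω ^ 2) + 4 * U ^ 2 * s ≤ U * (6 * U * s + 2 * U * ω) := by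
      have h7 := mul_le_mul_of_nonneg_right hT' (sq_nonneg ω)
      have h8 := mul_le_mul_of_nonneg_left ha2 hupos.le
      nlinarith
    have h9 : U ^ 2 * (C * (U * ω ^ 2)) ≤ U ^ 2 * (1 / 2) := by
      have : s = 1/4 - ω := by rw [hω]; ring
      rw [this] at h6
      nlinarith
    exact le_of_mul_le_mul_left h9 (by positivity)
  rw [hφr] at hge
  rw [le_div_iff₀ hC]
  have := mul_le_mul_of_nonneg_left hge hC.le
  change C * ((u 0).re * (1 / 4) ^ 2) ≤ C * (U * ω ^ 2) at this
  linarith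

lemma hasW_comp {n : ℕ} {G : (Fin n → ℂ) → ℂ} {f : ℂ → Fin n → ℂ} {ξ : Fin n → ℂ} {z : ℂ}
    (hG : DifferentiableAt ℝ G (f z)) (hf : HasDerivAt f ξ z) :
    HasW (fun x => G (f x)) (∑ k, wDeriv G (f z) k * ξ k)
      (∑ k, wbDeriv G (f z) k * conj (ξ k)) z := by
  refine ⟨_, hG.hasFDerivAt.comp z (hf.hasFDerivAt.restrictScalars ℝ), fun h => ?_⟩
  have e1 : ∀ k (c : ℂ), fderiv ℝ G (f z) (Pi.single k c) =
      wDeriv G (f z) k * c + wbDeriv G (f z) k * conj c := by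
    intro k c
    have : (Pi.single k c : Fin n → ℂ) = c.re • (Pi.single k 1 : Fin n → ℂ) +
        c.im • (Pi.single k Complex.I : Fin n → ℂ) := by
      rw [← Pi.single_smul, ← Pi.single_smul, ← Pi.single_add]
      congr 1
      simp
    rw [this, map_add, map_smul, map_smul, wDeriv, wbDeriv]
    have hc : conj c = c.re - c.im * Complex.I := by
      apply Complex.ext <;> simp
    rw [hc]
    have hc0 : c = c.re + c.im * Complex.I := (Complex.re_add_im c).symm
    simp only [Complex.real_smul]
    linear_combination (c.im * fderiv ℝ G (f z) (Pi.single k Complex.I)) * Complex.I_sq -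
      (1 / 2) * (fderiv ℝ G (f z) (Pi.single k 1) -
        Complex.I * fderiv ℝ G (f z) (Pi.single k Complex.I)) * hc0
  have e2 : h • ξ = ∑ k, (Pi.single k (h * ξ k) : Fin n → ℂ) := by
    rw [Finset.univ_sum_single]
    rfl
  have : (fderiv ℝ G (f z)) (h • ξ) = (∑ k, wDeriv G (f z) k * ξ k) * h +
      (∑ k, wbDeriv G (f z) k * conj (ξ k)) * conj h := by
    rw [e2, map_sum, Finset.sum_mul, Finset.sum_mul, ← Finset.sum_add_distrib]
    refine Finset.sum_congr rfl fun k _ => ?_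
    rw [e1, map_mul]
    ring
  simpa using this

section herm
variable {n : ℕ} (g : (Fin n → ℂ) → Matrix (Fin n) (Fin n) ℂ) (z : Fin n → ℂ)

lemma hermForm_add_left (v v' w : Fin n → ℂ) :
    hermForm g z (v + v') w = hermForm g z v w + hermForm g z v' w := by
  simp [hermForm, mul_add, add_mul, Finset.sum_add_distrib]

lemma hermForm_add_right (v w w' : Fin n → ℂ) :
    hermForm g z v (w + w') = hermForm g z v w + hermForm g z v w' := by
  simp [hermForm, mul_add, Finset.sum_add_distrib]

lemma hermForm_smul_left (c : ℂ) (v w : Fin n → ℂ) :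
    hermForm g z (c • v) w = c * hermForm g z v w := by
  simp only [hermForm, Finset.mul_sum, Pi.smul_apply, smul_eq_mul]
  refine Finset.sum_congr rfl fun _ _ => Finset.sum_congr rfl fun _ _ => by ring

lemma hermForm_smul_right (c : ℂ) (v w : Fin n → ℂ) :
    hermForm g z v (c • w) = conj c * hermForm g z v w := by
  simp only [hermForm, Finset.mul_sum, Pi.smul_apply, smul_eq_mul, map_mul]
  refine Finset.sum_congr rfl fun _ _ => Finset.sum_congr rfl fun _ _ => by ring

lemma hermForm_conj {g : (Fin n → ℂ) → Matrix (Fin n) (Fin n) ℂ} {z : Fin n → ℂ}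
    (h : (g z).IsHermitian) (v w : Fin n → ℂ) :
    conj (hermForm g z v w) = hermForm g z w v := by
  simp only [hermForm, map_sum, map_mul, Complex.conj_conj]
  rw [Finset.sum_comm]
  refine Finset.sum_congr rfl fun i _ => Finset.sum_congr rfl fun j _ => ?_
  have : conj (g z j i) = g z i j := h.apply i j
  rw [this]
  ring

lemma hermForm_eq_vecMul (v w : Fin n → ℂ) :
    hermForm g z v w = ∑ j, Matrix.vecMul v (g z) j * conj (w j) := by
  simp only [hermForm, Matrix.vecMul, dotProduct, Finset.sum_mul]
  rw [Finset.sum_comm]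
  refine Finset.sum_congr rfl fun i _ => Finset.sum_congr rfl fun j _ => by ring

end herm

lemma herm_key {n : ℕ} {g : (Fin n → ℂ) → Matrix (Fin n) (Fin n) ℂ} {z : Fin n → ℂ}
    (h : (g z).IsHermitian)
    (hp : ∀ v : Fin n → ℂ, v ≠ 0 → 0 < (hermForm g z v v).re)
    (ξ x b : Fin n → ℂ) (hξ : 0 < (hermForm g z ξ ξ).re) :
    Complex.normSq (hermForm g z x ξ + ∑ j, b j * conj (ξ j)) ≤
      (hermForm g z ξ ξ).re * (hermForm g z x x + ∑ j, b j * conj (x j) + ∑ j, conj (b j) * x j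
        + ∑ p, ∑ q, (g z)⁻¹ q p * b q * conj (b p)).re := by
  have hnn : ∀ v, 0 ≤ (hermForm g z v v).re := by
    intro v
    by_cases hv : v = 0
    · simp [hv, hermForm]
    · exact (hp v hv).le
  have hdet : IsUnit (g z).det := by
    rw [isUnit_iff_ne_zero]
    intro h0
    obtain ⟨v, hv, hv0⟩ := Matrix.exists_vecMul_eq_zero_iff.2 h0
    have := hp v hv
    rw [hermForm_eq_vecMul, hv0] at this
    simp at this
  obtain ⟨y, hy⟩ : ∃ y, y = Matrix.vecMul b (g z)⁻¹ := ⟨_, rfl⟩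
  have hyb : Matrix.vecMul y (g z) = b := by
    rw [hy, Matrix.vecMul_vecMul, Matrix.nonsing_inv_mul _ hdet, Matrix.vecMul_one]
  have hB : ∀ v, hermForm g z y v = ∑ j, b j * conj (v j) := by
    intro v; rw [hermForm_eq_vecMul, hyb]
  have hB' : ∀ v, hermForm g z v y = ∑ j, conj (b j) * v j := by
    intro v; rw [← hermForm_conj h, hB]; simp
  have hyy : hermForm g z y y = ∑ p, ∑ q, (g z)⁻¹ q p * b q * conj (b p) := by
    rw [hB']
    refine Finset.sum_congr rfl fun p _ => ?_
    rw [hy]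
    simp only [Matrix.vecMul, dotProduct, Finset.mul_sum]
    refine Finset.sum_congr rfl fun q _ => by ring
  have e1 : hermForm g z x ξ + ∑ j, b j * conj (ξ j) = hermForm g z (x + y) ξ := by
    rw [hermForm_add_left, hB]
  have e2 : hermForm g z x x + ∑ j, b j * conj (x j) + ∑ j, conj (b j) * x j
        + ∑ p, ∑ q, (g z)⁻¹ q p * b q * conj (b p) = hermForm g z (x + y) (x + y) := by
    rw [hermForm_add_left, hermForm_add_right, hermForm_add_right, hyy, hB x, hB' x]
    ring
  rw [e1, e2]
  generalize x + y = η
  set U := (hermForm g z ξ ξ).re with hU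
  have hreal : hermForm g z ξ ξ = (U : ℂ) :=
    (Complex.conj_eq_iff_re.1 (hermForm_conj h ξ ξ)).symm
  set N := hermForm g z η ξ with hN
  have hN' : hermForm g z ξ η = conj N := (hermForm_conj h η ξ).symm
  have h0 := hnn ((U:ℂ) • η + (-N) • ξ)
  have e3 : hermForm g z ((U:ℂ) • η + (-N) • ξ) ((U:ℂ) • η + (-N) • ξ) =
      ((U ^ 2 : ℝ) : ℂ) * hermForm g z η η - ((U * Complex.normSq N : ℝ) : ℂ) := by
    simp only [hermForm_add_left, hermForm_add_right, hermForm_smul_left, hermForm_smul_right,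
      hreal, hN', ← hN]
    push_cast
    rw [← Complex.mul_conj]
    simp
    ring
  rw [e3, Complex.sub_re, Complex.re_ofReal_mul, Complex.ofReal_re] at h0
  have : U * Complex.normSq N ≤ U * (U * (hermForm g z η η).re) := by linarith
  exact le_of_mul_le_mul_left this hξ

lemma wbDeriv_conj {n : ℕ} {G H : (Fin n → ℂ) → ℂ} {z : Fin n → ℂ} {k : Fin n}
    (hG : DifferentiableAt ℝ G z) (e : H =ᶠ[𝓝 z] fun x => conj (G x)) :
    wbDeriv H z k = conj (wDeriv G z k) := by
  have : HasFDerivAt H _ z :=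
    ((Complex.conjCLE.toContinuousLinearMap.hasFDerivAt (x := G z)).comp z
      hG.hasFDerivAt).congr_of_eventuallyEq e
  rw [wbDeriv, wDeriv, this.fderiv]
  simp [map_ofNat]

lemma sum_six {n : ℕ} (M : Fin n → Fin n → ℂ) (α β : Fin n → Fin n → Fin n → ℂ)
    (v w : Fin n → ℂ) :
    ∑ i, ∑ j, ∑ k, ∑ l, (∑ p, ∑ q, M q p * α i q k * β p j l) * v i * w j * v k * w l =
    ∑ p, ∑ q, M q p * (∑ i, ∑ k, α i q k * v k * v i) * (∑ j, ∑ l, β p j l * w l * w j) := by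
  have key : ∀ h : Fin n → Fin n → Fin n → Fin n → Fin n → Fin n → ℂ,
      ∑ i, ∑ j, ∑ k, ∑ l, ∑ p, ∑ q, h i j k l p q =
      ∑ p, ∑ q, ∑ j, ∑ l, ∑ i, ∑ k, h i j k l p q := by
    intro h
    let e : (Fin n × Fin n × Fin n × Fin n × Fin n × Fin n) ≃
        (Fin n × Fin n × Fin n × Fin n × Fin n × Fin n) :=
      ⟨fun x => (x.2.2.2.2.1, x.2.2.2.2.2, x.2.1, x.2.2.2.1, x.1, x.2.2.1),
       fun y => (y.2.2.2.2.1, y.2.2.1, y.2.2.2.2.2, y.2.2.2.1, y.1, y.2.1),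
       fun _ => rfl, fun _ => rfl⟩
    have := Fintype.sum_equiv e (fun x => h x.1 x.2.1 x.2.2.1 x.2.2.2.1 x.2.2.2.2.1 x.2.2.2.2.2)
      (fun y => h y.2.2.2.2.1 y.2.2.1 y.2.2.2.2.2 y.2.2.2.1 y.1 y.2.1) (fun _ => rfl)
    simpa only [Fintype.sum_prod_type] using this
  simp only [Finset.sum_mul, Finset.mul_sum]
  rw [key]
  refine Finset.sum_congr rfl fun _ _ => Finset.sum_congr rfl fun _ _ =>
    Finset.sum_congr rfl fun _ _ => Finset.sum_congr rfl fun _ _ =>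
    Finset.sum_congr rfl fun _ _ => Finset.sum_congr rfl fun _ _ => by ring

/-- the mixed second derivative term -/
lemma sum_curv {n : ℕ} (g : (Fin n → ℂ) → Matrix (Fin n) (Fin n) ℂ) (z v : Fin n → ℂ)
    (hc : ∀ i j l, wbDeriv (fun w => g w i j) z l = conj (wDeriv (fun w => g w j i) z l)) :
    ∑ i, ∑ j, ∑ k, ∑ l, curvTensor g z i j k l * v i * conj (v j) * v k * conj (v l) =
    - (∑ i, ∑ j, (∑ l, (∑ k, wDeriv (fun w => wbDeriv (fun u => g u i j) w l) z k * v k) *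
        conj (v l)) * v i * conj (v j)) +
    ∑ p, ∑ q, (g z)⁻¹ q p * (∑ i, ∑ k, wDeriv (fun w => g w i q) z k * v k * v i) *
      conj (∑ i, ∑ k, wDeriv (fun w => g w i p) z k * v k * v i) := by
  have h1 : ∀ p, conj (∑ i, ∑ k, wDeriv (fun w => g w i p) z k * v k * v i) =
      ∑ j, ∑ l, wbDeriv (fun w => g w p j) z l * conj (v l) * conj (v j) := by
    intro p
    simp only [map_sum, map_mul, hc]
  simp only [h1]
  rw [← sum_six (fun q p => (g z)⁻¹ q p)
    (fun i q k => wDeriv (fun w => g w i q) z k)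
    (fun p j l => wbDeriv (fun w => g w p j) z l) v (fun i => conj (v i))]
  simp only [← Finset.sum_neg_distrib, ← Finset.sum_add_distrib]
  refine Finset.sum_congr rfl fun i _ => Finset.sum_congr rfl fun j _ => ?_
  simp only [Finset.sum_add_distrib, curvTensor, add_mul]
  congr 1
  rw [Finset.sum_comm]
  simp only [Finset.sum_mul, ← Finset.sum_neg_distrib]
  refine Finset.sum_congr rfl fun i _ => Finset.sum_congr rfl fun j _ => by ring

lemma disc_bound {n : ℕ} {D : Set (Fin n → ℂ)} (hD : IsOpen D)
    {g : (Fin n → ℂ) → Matrix (Fin n) (Fin n) ℂ} (hg : IsHermitianMetricOn D g) {C : ℝ}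
    (hC : 0 < C) (hH : ∀ z ∈ D, ∀ v : Fin n → ℂ, v ≠ 0 → holSecCurv g z v ≤ -C)
    {f : ℂ → Fin n → ℂ} (hf : DifferentiableOn ℂ f (ball 0 1)) (hm : MapsTo f (ball 0 1) D) :
    (hermForm g (f 0) (deriv f 0) (deriv f 0)).re ≤ 8 / C := by
  have hF := hf.deriv isOpen_ball
  have hF2 := hF.deriv isOpen_ball
  obtain ⟨F, hFe⟩ : ∃ F, F = deriv f := ⟨_, rfl⟩
  obtain ⟨F', hFe'⟩ : ∃ F', F' = deriv F := ⟨_, rfl⟩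
  have d0 : ∀ z ∈ ball (0:ℂ) 1, HasDerivAt f (F z) z := fun z hz => by
    rw [hFe]; exact (hf.differentiableAt (isOpen_ball.mem_nhds hz)).hasDerivAt
  have d1 : ∀ z ∈ ball (0:ℂ) 1, ∀ i, HasW (fun x => F x i) (F' z i) 0 z := fun z hz i => by
    rw [hFe', hFe]
    exact HasW.of_hasDerivAt
      (hasDerivAt_pi.1 (hF.differentiableAt (isOpen_ball.mem_nhds hz)).hasDerivAt i)
  have d2 : ∀ z ∈ ball (0:ℂ) 1, ∀ i, ∃ c, HasW (fun x => F' x i) c 0 z := fun z hz i => by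
    rw [hFe', hFe]
    exact ⟨_, HasW.of_hasDerivAt
      (hasDerivAt_pi.1 (hF2.differentiableAt (isOpen_ball.mem_nhds hz)).hasDerivAt i)⟩
  have gd : ∀ p ∈ D, ∀ i j, ContDiffAt ℝ (⊤ : ℕ∞) (fun z => g z i j) p := fun p hp i j =>
    (hg.smooth i j).contDiffAt (hD.mem_nhds hp)
  have gd1 : ∀ p ∈ D, ∀ i j, DifferentiableAt ℝ (fun z => g z i j) p := fun p hp i j =>
    (gd p hp i j).differentiableAt (by simp)
  have gd2 : ∀ p ∈ D, ∀ i j l, DifferentiableAt ℝ (fun w => wbDeriv (fun z => g z i j) w l) p := by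
    intro p hp i j l
    have h : DifferentiableAt ℝ (fderiv ℝ (fun z => g z i j)) p :=
      ((gd p hp i j).fderiv_right (m := 1) (by norm_cast)).differentiableAt (by simp)
    unfold wbDeriv
    fun_prop
  have hc : ∀ p ∈ D, ∀ i j l,
      wbDeriv (fun w => g w i j) p l = conj (wDeriv (fun w => g w j i) p l) := by
    intro p hp i j l
    refine wbDeriv_conj (gd1 p hp j i) ?_
    filter_upwards [hD.mem_nhds hp] with w hw
    exact ((hg.hermitian w hw).apply i j).symm
  have hu : ∀ z ∈ ball (0:ℂ) 1, conj (hermForm g (f z) (F z) (F z)) = hermForm g (f z) (F z) (F z) :=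
    fun z hz => hermForm_conj (hg.hermitian _ (hm hz)) _ _
  rw [← hFe]
  let P : ℂ → ℂ := fun z => ∑ i, ∑ j,
    ((∑ k, wDeriv (fun w => g w i j) (f z) k * F z k) * F z i * conj (F z j) +
      g (f z) i j * F' z i * conj (F z j))
  let Q : ℂ → ℂ := fun z => ∑ i, ∑ j,
    ((∑ k, wbDeriv (fun w => g w i j) (f z) k * conj (F z k)) * F z i * conj (F z j) +
      g (f z) i j * F z i * conj (F' z j))
  let T : ℂ → ℂ := fun z => ∑ i, ∑ j,
    ((∑ l, (∑ k, wDeriv (fun w => wbDeriv (fun u => g u i j) w l) (f z) k * F z k) *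
        conj (F z l)) * F z i * conj (F z j) +
      (∑ k, wbDeriv (fun w => g w i j) (f z) k * conj (F z k)) * F' z i * conj (F z j) +
      (∑ k, wDeriv (fun w => g w i j) (f z) k * F z k) * F z i * conj (F' z j) +
      g (f z) i j * F' z i * conj (F' z j))
  have hW1 : ∀ z ∈ ball (0:ℂ) 1, HasW (fun z => hermForm g (f z) (F z) (F z)) (P z) (Q z) z := by
    intro z hz
    refine HasW.sum fun i _ => HasW.sum fun j _ => ?_
    have := ((hasW_comp (gd1 _ (hm hz) i j) (d0 z hz)).mul (d1 z hz i)).mul (d1 z hz j).conj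
    convert this using 1
    · simp; ring
    · simp
  refine ahlfors (u := fun z => hermForm g (f z) (F z) (F z)) (P := P) (Q := Q) (T := T) hC
    hW1 ?_ ?_ ?_ ?_
  · intro z hz
    have h2 : HasW (fun z => hermForm g (f z) (F z) (F z)) _ _ z := (hW1 z hz).conj.congr (by
      filter_upwards [isOpen_ball.mem_nhds hz] with x hx
      exact (hu x hx).symm)
    exact ((hW1 z hz).unique h2).1
  · intro z hz
    exact Complex.conj_eq_iff_im.1 (hu z hz)
  · intro z hz
    choose c hc' using d2 z hz
    refine HasW.sum_ex fun i => HasW.sum_ex fun j => ?_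
    have h1 := HasW.sum (s := Finset.univ) fun l _ =>
      (hasW_comp (gd2 _ (hm hz) i j l) (d0 z hz)).mul (d1 z hz l).conj
    have h2 := (h1.mul (d1 z hz i)).mul (d1 z hz j).conj
    have h3 := ((hasW_comp (gd1 _ (hm hz) i j) (d0 z hz)).mul (d1 z hz i)).mul (hc' j).conj
    have h4 := h2.add h3
    refine ⟨_, h4.cast_left ?_⟩
    simp
    ring
  · intro z hz hpos
    have hne : F z ≠ 0 := by
      intro h0
      rw [h0] at hpos
      simp [hermForm] at hpos
    have hK := hH _ (hm hz) _ hne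
    obtain ⟨b, hb⟩ : ∃ b : Fin n → ℂ, b = fun q =>
      ∑ i, ∑ k, wDeriv (fun w => g w i q) (f z) k * F z k * F z i := ⟨_, rfl⟩
    have key := herm_key (hg.hermitian _ (hm hz)) (hg.posdef _ (hm hz)) (F z) (F' z) b hpos
    have hb1 : ∀ x : Fin n → ℂ, ∑ j, b j * conj (x j) = ∑ i, ∑ j,
        (∑ k, wDeriv (fun w => g w i j) (f z) k * F z k) * F z i * conj (x j) := by
      intro x
      rw [Finset.sum_comm]
      simp only [hb, Finset.sum_mul]
    have hb2 : ∑ j, conj (b j) * F' z j = ∑ i, ∑ j,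
        (∑ k, wbDeriv (fun w => g w i j) (f z) k * conj (F z k)) * F' z i * conj (F z j) := by
      simp only [hb, map_sum, map_mul, Finset.sum_mul, hc _ (hm hz)]
      refine Finset.sum_congr rfl fun _ _ => Finset.sum_congr rfl fun _ _ =>
        Finset.sum_congr rfl fun _ _ => by ring
    have hP : P z = hermForm g (f z) (F' z) (F z) + ∑ j, b j * conj (F z j) := by
      rw [hb1]
      simp only [P, hermForm, Finset.sum_add_distrib]
      ring
    have hS := sum_curv g (f z) (F z) (hc _ (hm hz))
    unfold holSecCurv at hK
    rw [hS, div_le_iff₀ (by positivity)] at hK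
    have hTT : T z = -(- (∑ i, ∑ j, (∑ l, (∑ k, wDeriv (fun w => wbDeriv (fun u => g u i j) w l)
        (f z) k * F z k) * conj (F z l)) * F z i * conj (F z j)) +
        ∑ p, ∑ q, (g (f z))⁻¹ q p * b q * conj (b p)) +
        (hermForm g (f z) (F' z) (F' z) + ∑ j, b j * conj (F' z j) + ∑ j, conj (b j) * F' z j
        + ∑ p, ∑ q, (g (f z))⁻¹ q p * b q * conj (b p)) := by
      rw [hb1, hb2]
      simp only [T, hermForm, Finset.sum_add_distrib]
      ring
    simp only [hb] at hK key hTT hP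
    rw [hP, hTT, Complex.add_re, Complex.neg_re, mul_add]
    have := mul_le_mul_of_nonneg_left hK hpos.le
    refine add_le_add ?_ key
    linarith

end helpers

/-- if a bounded domain `D ⊆ ℂⁿ` carries a Kähler metric `g` with holomorphic
sectional curvature `≤ -C₁ < 0`, then `√(g(v,v)) ≤ C₁' ⬝ K_D(p, v)` for all `p ∈ D`, `v`,
where `C₁'` depends only on `C₁`. -/
theorem metric_le_kobayashi_of_negative_holSecCurv
    (C₁ : ℝ) (hC₁ : 0 < C₁) :
    ∃ C₁' > (0:ℝ), ∀ (n : ℕ) (D : Set (Fin n → ℂ)),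
      IsOpen D → D.Nonempty → Bornology.IsBounded D →
      ∀ g : (Fin n → ℂ) → Matrix (Fin n) (Fin n) ℂ,
        IsKahlerMetricOn D g →
        (∀ z ∈ D, ∀ v : Fin n → ℂ, v ≠ 0 → holSecCurv g z v ≤ -C₁) →
        ∀ p ∈ D, ∀ v : Fin n → ℂ,
          Real.sqrt ((hermForm g p v v).re) ≤ C₁' * kobMetric D p v := by
  refine ⟨Real.sqrt (8 / C₁), by positivity, ?_⟩
  intro n D hD _ _ g hg hH p hp v
  have hne : {α : ℝ | 0 < α ∧ ∃ f : ℂ → (Fin n → ℂ), DifferentiableOn ℂ f (ball (0:ℂ) 1) ∧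
      MapsTo f (ball (0:ℂ) 1) D ∧ f 0 = p ∧ fderiv ℂ f 0 1 = α⁻¹ • v}.Nonempty := by
    obtain ⟨ε, hε, hball⟩ := Metric.isOpen_iff.1 hD p hp
    have hα : 0 < (‖v‖ + 1) / ε := by positivity
    have hd : ∀ z : ℂ, HasDerivAt (fun z : ℂ => p + z • (((‖v‖ + 1) / ε)⁻¹ • v))
        (((‖v‖ + 1) / ε)⁻¹ • v) z := by
      intro z
      simpa using ((hasDerivAt_id z).smul_const (((‖v‖ + 1) / ε)⁻¹ • v)).const_add p
    refine ⟨(‖v‖ + 1) / ε, hα, fun z => p + z • (((‖v‖ + 1) / ε)⁻¹ • v),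
      fun z _ => (hd z).differentiableAt.differentiableWithinAt, fun z hz => hball ?_, by simp, ?_⟩
    · have hz' : ‖z‖ < 1 := by simpa using hz
      rw [mem_ball_iff_norm, add_sub_cancel_left, norm_smul, norm_smul, Real.norm_of_nonneg
        (by positivity), inv_div]
      have h1 : ε / (‖v‖ + 1) * ‖v‖ < ε := by
        rw [div_mul_eq_mul_div, div_lt_iff₀ (by positivity)]
        nlinarith
      have h2 : 0 ≤ ε / (‖v‖ + 1) * ‖v‖ := by positivity
      nlinarith [norm_nonneg z]
    · rw [fderiv_apply_one_eq_deriv]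
      exact (hd 0).deriv
  have hs : 0 < Real.sqrt (8 / C₁) := by positivity
  rw [← div_le_iff₀' hs]
  refine le_csInf hne ?_
  rintro α ⟨hα, f, hf, hm, hf0, hfv⟩
  have hb := disc_bound hD hg.toIsHermitianMetricOn hC₁ hH hf hm
  rw [fderiv_apply_one_eq_deriv] at hfv
  have hv : v = (α : ℂ) • deriv f 0 := by
    rw [hfv, Complex.coe_smul, smul_smul, mul_inv_cancel₀ hα.ne', one_smul]
  rw [div_le_iff₀' hs]
  have e : (hermForm g p v v).re = α ^ 2 * (hermForm g (f 0) (deriv f 0) (deriv f 0)).re := by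
    rw [hf0]
    nth_rw 1 2 [hv]
    rw [hermForm_smul_left, hermForm_smul_right, Complex.conj_ofReal, ← mul_assoc,
      ← Complex.ofReal_mul, Complex.re_ofReal_mul]
    ring
  rw [e, Real.sqrt_mul (sq_nonneg α), Real.sqrt_sq hα.le, mul_comm]
  exact mul_le_mul_of_nonneg_right (Real.sqrt_le_sqrt hb) hα.le
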